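/- Let 𝒢 be a compact principal ample groupoid. Then there exists a compact open subset Y ⊆ 𝒢⁰ meeting every orbit in exactly one point, and for any such Y one has 𝒢_Y^Y = Y. -/

import Mathlib

universe u

/-- The algebraic operations of a groupoid (identified with its set of arrows):
a (partially meaningful) composition `gmul` and an inversion `ginv`.  The product
`gmul g h` is only required to behave like composition when `g` and `h` are
composable, i.e. when `src g = rng h`. -/
class GroupoidOps (G : Type u) where
  gmul : G → G → G
  ginv : G → G

namespace GroupoidOps

variable {G : Type u} [GroupoidOps G]

/-- The source map `s g = g⁻¹ g`. -/
def src (g : G) : G := gmul (ginv g) g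

/-- The range map `r g = g g⁻¹`. -/
def rng (g : G) : G := gmul g (ginv g)

/-- The unit space `𝒢⁰`: the set of identity arrows. -/
def unitSpace (G : Type u) [GroupoidOps G] : Set G := {x : G | src x = x}

end GroupoidOps

open GroupoidOps

/-- A topological groupoid: a groupoid `G`, identified with its arrow space, equipped
with a topology such that inversion is continuous and composition is continuous on the
set of composable pairs. -/
class TopologicalGroupoid (G : Type u) extends TopologicalSpace G, GroupoidOps G where
  ginv_ginv : ∀ g : G, ginv (ginv g) = g
  gmul_src : ∀ g : G, gmul g (src g) = g
  rng_gmul : ∀ g : G, gmul (rng g) g = g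
  gmul_assoc : ∀ g h k : G, src g = rng h → src h = rng k →
    gmul (gmul g h) k = gmul g (gmul h k)
  src_gmul : ∀ g h : G, src g = rng h → src (gmul g h) = src h
  rng_gmul_comp : ∀ g h : G, src g = rng h → rng (gmul g h) = rng g
  ginv_gmul : ∀ g h : G, src g = rng h → ginv (gmul g h) = gmul (ginv h) (ginv g)
  ginv_unit : ∀ x : G, src x = x → ginv x = x
  src_src : ∀ g : G, src (src g) = src g
  src_rng : ∀ g : G, src (rng g) = rng g
  continuous_ginv : Continuous (ginv : G → G)
  continuous_gmul : Continuous fun p : {p : G × G // src p.1 = rng p.2} => gmul p.1.1 p.1.2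

/-- An ample groupoid: a topological groupoid (not necessarily Hausdorff) whose unit
space is locally compact, Hausdorff and totally disconnected in the subspace topology,
and whose source map, viewed as a map `G → 𝒢⁰`, is a local homeomorphism. -/
class AmpleGroupoid (G : Type u) extends TopologicalGroupoid G where
  t2_unitSpace : T2Space (unitSpace G)
  locallyCompact_unitSpace : LocallyCompactSpace (unitSpace G)
  totallyDisconnected_unitSpace : TotallyDisconnectedSpace (unitSpace G)
  isLocalHomeomorph_src :
    IsLocalHomeomorph fun g : G => (⟨src g, TopologicalGroupoid.src_src g⟩ : unitSpace G)

namespace TopologicalGroupoid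

variable {G : Type u} [TopologicalGroupoid G]

/-- A bisection: an open subset on which both the source and the range map are injective. -/
def IsBisection (U : Set G) : Prop :=
  IsOpen U ∧ Set.InjOn (src : G → G) U ∧ Set.InjOn (rng : G → G) U

/-- A compact bisection: a bisection which is compact
(quasi-compact and Hausdorff in the subspace topology). -/
def IsCompactBisection (U : Set G) : Prop :=
  IsBisection U ∧ IsCompact U ∧ T2Space U

/-- Setwise inverse `U⁻¹ = { u⁻¹ : u ∈ U }`. -/
def setInv (U : Set G) : Set G := ginv '' U

/-- Setwise product `UV = { uv : u ∈ U, v ∈ V, s(u) = r(v) }`. -/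
def setMul (U V : Set G) : Set G :=
  {x : G | ∃ u ∈ U, ∃ v ∈ V, src u = rng v ∧ x = gmul u v}

/-- A subgroupoid: a subset closed under inversion and (composable) composition. -/
def IsSubgroupoid (H : Set G) : Prop :=
  (∀ g ∈ H, ginv g ∈ H) ∧ ∀ g ∈ H, ∀ h ∈ H, src g = rng h → gmul g h ∈ H

/-- A groupoid is principal if every isotropy element is a unit. -/
def IsPrincipal (G : Type u) [TopologicalGroupoid G] : Prop :=
  ∀ g : G, src g = rng g → g ∈ unitSpace G

/-- The orbit of `x`, namely `r(s⁻¹(x))`. -/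
def orbit (x : G) : Set G := {y : G | ∃ g : G, src g = x ∧ rng g = y}

/-- A subset of the unit space is invariant if it is a union of orbits. -/
def IsInvariant (U : Set G) : Prop := ∀ g : G, src g ∈ U → rng g ∈ U

/-- An inverse semigroup of compact bisections: a nonempty collection of compact
bisections closed under setwise product and setwise inverse. -/
def IsInvSemigroupOfCompactBisections (S : Set (Set G)) : Prop :=
  S.Nonempty ∧ (∀ U ∈ S, IsCompactBisection U) ∧
    (∀ U ∈ S, setInv U ∈ S) ∧ ∀ U ∈ S, ∀ V ∈ S, setMul U V ∈ S

/-- The orbit equivalence relation `𝓡` on the unit space. -/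
def orbitRel (G : Type u) [TopologicalGroupoid G] :
    unitSpace G → unitSpace G → Prop :=
  fun x y => ∃ g : G, src g = (x : G) ∧ rng g = (y : G)

end TopologicalGroupoid

open TopologicalGroupoid

namespace TopologicalGroupoid

variable {G : Type u} [TopologicalGroupoid G]

theorem src_ginv (g : G) : src (ginv g) = rng g := by
  simp only [src, rng, ginv_ginv]

theorem rng_ginv (g : G) : rng (ginv g) = src g := by
  simp only [src, rng, ginv_ginv]

theorem rng_of_mem_unitSpace {x : G} (hx : x ∈ unitSpace G) : rng x = x := by
  rw [← src_ginv, ginv_unit x hx]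
  exact hx

theorem isOpenMap_ginv : IsOpenMap (ginv : G → G) :=
  (Homeomorph.mk ⟨ginv, ginv, ginv_ginv, ginv_ginv⟩ continuous_ginv
    continuous_ginv).isOpenMap

/-- The source map with values in the unit space. -/
def srcUnit (g : G) : unitSpace G := ⟨src g, src_src g⟩

/-- The range map with values in the unit space. -/
def rngUnit (g : G) : unitSpace G := ⟨rng g, src_rng g⟩

theorem rngUnit_eq_srcUnit_comp_ginv :
    (rngUnit : G → unitSpace G) = srcUnit ∘ ginv :=
  funext fun g => Subtype.ext (src_ginv g).symm

theorem srcUnit_surjective : Function.Surjective (srcUnit : G → unitSpace G) :=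
  fun x => ⟨x, Subtype.ext x.2⟩

theorem orbitRel_equivalence : Equivalence (orbitRel G) where
  refl x := ⟨x, x.2, rng_of_mem_unitSpace x.2⟩
  symm := by
    rintro x y ⟨g, hs, hr⟩
    exact ⟨ginv g, (src_ginv g).trans hr, (rng_ginv g).trans hs⟩
  trans := by
    rintro x y z ⟨g, hgs, hgr⟩ ⟨h, hhs, hhr⟩
    have hc : src h = rng g := hhs.trans hgr.symm
    exact ⟨gmul h g, (src_gmul h g hc).trans hgs, (rng_gmul_comp h g hc).trans hhr⟩

/-- The union of all orbits meeting `Y`. -/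
def saturation (Y : Set (unitSpace G)) : Set (unitSpace G) :=
  {x | ∃ y ∈ Y, orbitRel G y x}

theorem saturation_eq_image (Y : Set (unitSpace G)) :
    saturation Y = rngUnit '' (srcUnit ⁻¹' Y) := by
  ext x
  constructor
  · rintro ⟨y, hy, g, hs, hr⟩
    refine ⟨g, ?_, Subtype.ext hr⟩
    rwa [Set.mem_preimage, show srcUnit g = y from Subtype.ext hs]
  · rintro ⟨g, hg, rfl⟩
    exact ⟨_, hg, g, rfl, rfl⟩

/-- A set of units is a partial transversal if it meets every orbit at most once. -/
def IsPartialTransversal (Y : Set (unitSpace G)) : Prop :=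
  ∀ x ∈ Y, ∀ y ∈ Y, orbitRel G x y → x = y

theorem IsPartialTransversal.union_diff_saturation {Y Z : Set (unitSpace G)}
    (hY : IsPartialTransversal Y) (hZ : IsPartialTransversal Z) :
    IsPartialTransversal (Y ∪ (Z \ saturation Y)) := by
  rintro x (hx | hx) y (hy | hy) h
  · exact hY x hx y hy h
  · exact absurd ⟨x, hx, h⟩ hy.2
  · exact absurd ⟨y, hy, orbitRel_equivalence.symm h⟩ hx.2
  · exact hZ x hx.1 y hy.1 h

theorem saturation_union_subset (Y Z : Set (unitSpace G)) :
    saturation Y ∪ saturation Z ⊆ saturation (Y ∪ (Z \ saturation Y)) := by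
  rintro x (⟨y, hy, h⟩ | ⟨z, hz, h⟩)
  · exact ⟨y, Or.inl hy, h⟩
  · by_cases hzY : z ∈ saturation Y
    · obtain ⟨y, hy, h'⟩ := hzY
      exact ⟨y, Or.inl hy, orbitRel_equivalence.trans h' h⟩
    · exact ⟨z, Or.inr ⟨hz, hzY⟩, h⟩

end TopologicalGroupoid

namespace AmpleGroupoid

variable {G : Type u} [AmpleGroupoid G]

theorem isLocalHomeomorph_srcUnit : IsLocalHomeomorph (srcUnit : G → unitSpace G) :=
  isLocalHomeomorph_src

theorem continuous_srcUnit : Continuous (srcUnit : G → unitSpace G) :=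
  isLocalHomeomorph_srcUnit.continuous

theorem continuous_rngUnit : Continuous (rngUnit : G → unitSpace G) := by
  rw [rngUnit_eq_srcUnit_comp_ginv]
  exact continuous_srcUnit.comp continuous_ginv

theorem isOpenMap_rngUnit : IsOpenMap (rngUnit : G → unitSpace G) := by
  rw [rngUnit_eq_srcUnit_comp_ginv]
  exact isLocalHomeomorph_srcUnit.isOpenMap.comp isOpenMap_ginv

theorem isOpen_unitSpace : IsOpen (unitSpace G) := by
  rw [isOpen_iff_mem_nhds]
  intro x hx
  obtain ⟨e, hxe, he⟩ := isLocalHomeomorph_srcUnit x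
  have hsrc : Continuous (src : G → G) := continuous_subtype_val.comp continuous_srcUnit
  have hx' : src x ∈ e.source := by rwa [show src x = x from hx]
  filter_upwards [e.open_source.mem_nhds hxe,
    (e.open_source.preimage hsrc).mem_nhds hx'] with g hg hsg
  refine e.injOn hsg hg ?_
  rw [← he]
  exact Subtype.ext (src_src g)

theorem compactSpace_unitSpace [CompactSpace G] : CompactSpace (unitSpace G) :=
  srcUnit_surjective.compactSpace continuous_srcUnit

theorem isClopen_saturation [CompactSpace G] {Y : Set (unitSpace G)} (hY : IsClopen Y) :
    IsClopen (saturation Y) := by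
  have := t2_unitSpace (G := G)
  rw [saturation_eq_image]
  exact ⟨((hY.1.preimage continuous_srcUnit).isCompact.image continuous_rngUnit).isClosed,
    isOpenMap_rngUnit _ (hY.2.preimage continuous_srcUnit)⟩

theorem exists_isClopen_isPartialTransversal_mem [CompactSpace G] (hprin : IsPrincipal G)
    (x : unitSpace G) : ∃ V, IsClopen V ∧ IsPartialTransversal V ∧ x ∈ V := by
  have := t2_unitSpace (G := G)
  have := totallyDisconnected_unitSpace (G := G)
  have := compactSpace_unitSpace (G := G)
  let K : Set (unitSpace G × unitSpace G) :=
    (fun g => (srcUnit g, rngUnit g)) '' (unitSpace G)ᶜ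
  have hK : IsClosed K :=
    (isOpen_unitSpace.isClosed_compl.isCompact.image
      (continuous_srcUnit.prodMk continuous_rngUnit)).isClosed
  have hxK : (x, x) ∈ Kᶜ := by
    rintro ⟨g, hg, h⟩
    obtain ⟨hs, hr⟩ := Prod.ext_iff.1 h
    exact hg (hprin g (congrArg Subtype.val (hs.trans hr.symm)))
  obtain ⟨U, W, hU, hW, hxU, hxW, hUW⟩ := isOpen_prod_iff.1 hK.isOpen_compl x x hxK
  obtain ⟨V, hV, hxV, hVUW⟩ := compact_exists_isClopen_in_isOpen (hU.inter hW) ⟨hxU, hxW⟩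
  refine ⟨V, hV, ?_, hxV⟩
  rintro y hy z hz ⟨g, hs, hr⟩
  by_cases hg : g ∈ unitSpace G
  · refine Subtype.ext ?_
    rw [← hs, ← hr, rng_of_mem_unitSpace hg]
    exact hg
  · exact absurd ⟨g, hg, Prod.ext (Subtype.ext hs) (Subtype.ext hr)⟩
      (hUW (Set.mk_mem_prod (hVUW hy).1 (hVUW hz).2))

theorem exists_isClopen_isPartialTransversal_saturation_eq_univ [CompactSpace G]
    (hprin : IsPrincipal G) :
    ∃ Y : Set (unitSpace G), IsClopen Y ∧ IsPartialTransversal Y ∧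
      saturation Y = Set.univ := by
  have := compactSpace_unitSpace (G := G)
  suffices h : ∃ Y : Set (unitSpace G), IsClopen Y ∧ IsPartialTransversal Y ∧
      Set.univ ⊆ saturation Y by simpa only [Set.univ_subset_iff] using h
  refine isCompact_univ.induction_on
    (p := fun s => ∃ Y, IsClopen Y ∧ IsPartialTransversal Y ∧ s ⊆ saturation Y) ?_ ?_ ?_ ?_
  · exact ⟨∅, isClopen_empty, fun x hx => hx.elim, Set.empty_subset _⟩
  · rintro s t hst ⟨Y, hY, hY', ht⟩
    exact ⟨Y, hY, hY', hst.trans ht⟩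
  · rintro s t ⟨Y, hY, hY', hs⟩ ⟨Z, hZ, hZ', ht⟩
    exact ⟨Y ∪ (Z \ saturation Y), hY.union (hZ.diff (isClopen_saturation hY)),
      hY'.union_diff_saturation hZ',
      (Set.union_subset_union hs ht).trans (saturation_union_subset Y Z)⟩
  · intro x _
    obtain ⟨V, hV, hV', hxV⟩ := exists_isClopen_isPartialTransversal_mem hprin x
    exact ⟨V, mem_nhdsWithin_of_mem_nhds (hV.2.mem_nhds hxV), V, hV, hV',
      fun y hy => ⟨y, hy, orbitRel_equivalence.refl y⟩⟩

end AmpleGroupoid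

/-- Let `𝒢` be a compact principal ample groupoid.  Then there is a
compact open `Y ⊆ 𝒢⁰` meeting every orbit exactly once, and for any such `Y` one has
`𝒢_Y^Y = Y`. -/
theorem exists_full_transversal (G : Type u) [AmpleGroupoid G]
    [CompactSpace G] [T2Space G] (hprin : IsPrincipal G) :
    (∃ Y : Set G, Y ⊆ unitSpace G ∧ IsCompact Y ∧
      IsOpen (Subtype.val ⁻¹' Y : Set (unitSpace G)) ∧
      ∀ x ∈ unitSpace G, ∃! y : G, y ∈ Y ∩ orbit x) ∧
    ∀ Y : Set G, Y ⊆ unitSpace G → IsCompact Y →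
      IsOpen (Subtype.val ⁻¹' Y : Set (unitSpace G)) →
      (∀ x ∈ unitSpace G, ∃! y : G, y ∈ Y ∩ orbit x) →
      {g : G | src g ∈ Y ∧ rng g ∈ Y} = Y := by
  constructor
  · have := AmpleGroupoid.compactSpace_unitSpace (G := G)
    obtain ⟨Y, hY, hinj, hsat⟩ :=
      AmpleGroupoid.exists_isClopen_isPartialTransversal_saturation_eq_univ hprin
    refine ⟨Subtype.val '' Y, Subtype.coe_image_subset _ _,
      hY.1.isCompact.image continuous_subtype_val, ?_, ?_⟩
    · rw [Set.preimage_image_eq _ Subtype.val_injective]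
      exact hY.2
    · intro x hx
      obtain ⟨y, hy, hyx⟩ : (⟨x, hx⟩ : unitSpace G) ∈ saturation Y := hsat ▸ Set.mem_univ _
      refine ⟨y, ⟨⟨y, hy, rfl⟩, orbitRel_equivalence.symm hyx⟩, ?_⟩
      rintro _ ⟨⟨z, hz, rfl⟩, hxz⟩
      exact congrArg Subtype.val
        (hinj y hy z hz (orbitRel_equivalence.trans hyx hxz)).symm
  · intro Y hYunit _ _ hY
    ext g
    constructor
    · rintro ⟨hs, hr⟩
      have hg : g ∈ unitSpace G := hprin g <|
        (hY (src g) (src_src g)).unique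
          ⟨hs, src g, src_src g, rng_of_mem_unitSpace (src_src g)⟩ ⟨hr, g, rfl, rfl⟩
      rwa [show src g = g from hg] at hs
    · intro hg
      refine ⟨?_, ?_⟩
      · rwa [show src g = g from hYunit hg]
      · rwa [rng_of_mem_unitSpace (hYunit hg)]
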